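/- Let d be a real number with 0 ≤ d < 1/2. Then the iterated integral ∫₀¹∫₀^{y₁}∫₀^{y₂}∫₀^{y₃}∫₀^{y₄} (y₂−y₃)^(−d)(y₃−y₄)^(−d)(y₁−y₄)^(−d)(y₁−y₅)^(−d)(y₂−y₅)^(−d) dy₅ dy₄ dy₃ dy₂ dy₁ equals (Γ(1−d)²/(3(1−d)))·(Γ(4−5d)/(Γ(6−5d)·Γ(3−2d)))·₃F₂(1, d, 3−3d; 3−2d, 4−3d; 1). -/

import Mathlib

open Real

noncomputable def poch (a : ℝ) (k : ℕ) : ℝ := ∏ i ∈ Finset.range k, (a + i)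

noncomputable def F21 (a b c x : ℝ) : ℝ :=
  ∑' k : ℕ, poch a k * poch b k / (poch c k * (Nat.factorial k : ℝ)) * x ^ k

noncomputable def F32 (a b c e f : ℝ) : ℝ :=
  ∑' k : ℕ, poch a k * poch b k * poch c k / (poch e k * poch f k * (Nat.factorial k : ℝ))

noncomputable def F32x (a b c e f x : ℝ) : ℝ :=
  ∑' k : ℕ, poch a k * poch b k * poch c k / (poch e k * poch f k * (Nat.factorial k : ℝ)) * x ^ k

noncomputable def F43 (a b c g e f h : ℝ) : ℝ :=
  ∑' k : ℕ, poch a k * poch b k * poch c k * poch g k /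
    (poch e k * poch f k * poch h k * (Nat.factorial k : ℝ))

open MeasureTheory Set ENNReal ProbabilityTheory

noncomputable def qq (a t : ℝ) : ℝ≥0∞ := if 0 < t then ENNReal.ofReal (t ^ a) else 0

lemma qq_pos {t : ℝ} (a : ℝ) (h : 0 < t) : qq a t = ENNReal.ofReal (t ^ a) := if_pos h
lemma qq_neg {t : ℝ} (a : ℝ) (h : t ≤ 0) : qq a t = 0 := if_neg h.not_gt

lemma qq_meas (a : ℝ) : Measurable (qq a) :=
  Measurable.ite measurableSet_Ioi (by fun_prop) (by fun_prop)

@[fun_prop]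
lemma qq_meas' {α : Type*} [MeasurableSpace α] (a : ℝ) (f : α → ℝ) (hf : Measurable f) :
    Measurable (fun x => qq a (f x)) := (qq_meas a).comp hf

lemma qq_scale (a : ℝ) {l : ℝ} (t : ℝ) (hl : 0 < l) :
    qq a (l * t) = ENNReal.ofReal (l ^ a) * qq a t := by
  rcases le_or_gt t 0 with h | h
  · rw [qq_neg _ h, qq_neg _ (mul_nonpos_of_nonneg_of_nonpos hl.le h), mul_zero]
  · rw [qq_pos _ h, qq_pos _ (mul_pos hl h), Real.mul_rpow hl.le h.le,
      ENNReal.ofReal_mul (by positivity)]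

lemma qq_mul (a b t : ℝ) : qq a t * qq b t = qq (a + b) t := by
  rcases le_or_gt t 0 with h | h
  · rw [qq_neg a h, qq_neg (a + b) h, zero_mul]
  · rw [qq_pos _ h, qq_pos _ h, qq_pos _ h, Real.rpow_add h, ENNReal.ofReal_mul (by positivity)]

lemma qq_beta {a b : ℝ} (ha : -1 < a) (hb : -1 < b) :
    ∫⁻ t, qq a t * qq b (1 - t) = ENNReal.ofReal (beta (a + 1) (b + 1)) := by
  have hpos : 0 < beta (a + 1) (b + 1) := beta_pos (by linarith) (by linarith)
  have h := lintegral_betaPDF_eq_one (α := a + 1) (β := b + 1) (by linarith) (by linarith)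
  have e : ∀ t, qq a t * qq b (1 - t) =
      ENNReal.ofReal (beta (a + 1) (b + 1)) * betaPDF (a + 1) (b + 1) t := by
    intro t
    rw [betaPDF_eq]
    split_ifs with ht
    · rw [qq_pos _ ht.1, qq_pos _ (by linarith [ht.2]), ← ENNReal.ofReal_mul (by have := ht.1; positivity),
        ← ENNReal.ofReal_mul hpos.le]
      congr 1
      rw [add_sub_cancel_right, add_sub_cancel_right]
      field_simp
    · rw [not_and_or] at ht
      rcases ht with ht | ht
      · rw [qq_neg _ (not_lt.1 ht)]; simp
      · rw [qq_neg b (by linarith)]; simp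
  simp_rw [e]
  rw [lintegral_const_mul', h, mul_one]
  exact ENNReal.ofReal_ne_top

lemma subst_aff (g : ℝ → ℝ≥0∞) (hg : Measurable g) (c : ℝ) {l : ℝ} (hl : 0 < l) :
    ∫⁻ y, g y = ENNReal.ofReal l * ∫⁻ x, g (c + l * x) := by
  rw [← lintegral_add_left_eq_self g c]
  conv_lhs => rw [← Real.smul_map_volume_mul_left hl.ne']
  rw [lintegral_smul_measure, lintegral_map (by fun_prop) (by fun_prop), abs_of_pos hl, smul_eq_mul]

lemma qq_conv {a b : ℝ} (ha : -1 < a) (hb : -1 < b) (x z : ℝ) :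
    ∫⁻ y, qq a (x - y) * qq b (y - z) =
      ENNReal.ofReal (beta (b + 1) (a + 1)) * qq (a + b + 1) (x - z) := by
  rcases le_or_gt (x - z) 0 with h | h
  · rw [qq_neg _ h, mul_zero]
    simp only [lintegral_eq_zero_iff (show Measurable fun y => qq a (x - y) * qq b (y - z) by fun_prop)]
    refine Filter.Eventually.of_forall fun y => ?_
    rcases le_or_gt (x - y) 0 with h' | h'
    · simp [qq_neg a h']
    · simp [qq_neg b (show y - z ≤ 0 by linarith)]
  · rw [subst_aff _ (by fun_prop) z h]
    have e : ∀ t, qq a (x - (z + (x - z) * t)) * qq b (z + (x - z) * t - z) =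
        ENNReal.ofReal ((x - z) ^ a * (x - z) ^ b) * (qq b t * qq a (1 - t)) := by
      intro t
      rw [show x - (z + (x - z) * t) = (x - z) * (1 - t) by ring,
        show z + (x - z) * t - z = (x - z) * t by ring, qq_scale _ _ h, qq_scale _ _ h,
        ENNReal.ofReal_mul (by positivity)]
      ring
    simp_rw [e]
    rw [lintegral_const_mul' _ _ ENNReal.ofReal_ne_top, qq_beta hb ha, qq_pos _ h, ← mul_assoc,
      ← ENNReal.ofReal_mul h.le, mul_comm, Real.rpow_add h, Real.rpow_add h, Real.rpow_one]
    congr 2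
    ring

lemma step {b : ℝ} (hb : 0 < b) (g : ℝ → ℝ) (G : ℝ → ℝ≥0∞) (hG : Measurable G)
    (h : ∀ x, 0 < x → x < b → G x < ∞ → g x = (G x).toReal)
    (h0 : ∀ x, (x ≤ 0 ∨ b ≤ x) → G x = 0) (hfin : ∫⁻ x, G x < ∞) :
    ∫ x in (0:ℝ)..b, g x = (∫⁻ x, G x).toReal := by
  have hae : ∀ᵐ x, G x < ∞ := ae_lt_top hG hfin.ne
  rw [← integral_toReal hG.aemeasurable hae, intervalIntegral.integral_of_le hb.le,
    integral_Ioc_eq_integral_Ioo, ← integral_indicator measurableSet_Ioo]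
  refine integral_congr_ae ?_
  filter_upwards [hae] with x hx
  by_cases hm : x ∈ Ioo 0 b
  · rw [indicator_of_mem hm, h x hm.1 hm.2 hx]
  · rw [indicator_of_notMem hm, h0 x, ENNReal.toReal_zero]
    simp only [mem_Ioo, not_and_or, not_lt] at hm
    exact hm

lemma poch_succ (a : ℝ) (k : ℕ) : poch a (k+1) = poch a k * (a + k) := by
  simp [poch, Finset.prod_range_succ]

lemma poch_pos {a : ℝ} (ha : 0 < a) (k : ℕ) : 0 < poch a k :=
  Finset.prod_pos fun i _ => by positivity

lemma poch_nonneg {a : ℝ} (ha : 0 ≤ a) (k : ℕ) : 0 ≤ poch a k :=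
  Finset.prod_nonneg fun i _ => by positivity

lemma choose_eq (d : ℝ) (k : ℕ) : Ring.choose (d + k - 1) k = poch d k / k.factorial := by
  have hk : (k.factorial : ℝ) ≠ 0 := by positivity
  rw [eq_div_iff hk]
  have : ∀ k, (ascPochhammer ℝ k).eval d = poch d k := by
    intro k
    induction k with
    | zero => simp [poch]
    | succ n ih => rw [ascPochhammer_succ_eval, ih, poch_succ]
  rw [← this, ← Polynomial.ascPochhammer_smeval_eq_eval, ← Ring.factorial_nsmul_multichoose_eq_ascPochhammer,
    Ring.choose, show d + k - 1 - k + 1 = d by ring]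
  simp [mul_comm]

lemma binom (d : ℝ) {u : ℝ} (h0 : 0 < u) (h1 : u < 1) :
    HasSum (fun k : ℕ => poch d k / k.factorial * u ^ k) ((1 - u) ^ (-d)) := by
  have h := (Real.one_div_one_sub_rpow_hasFPowerSeriesOnBall_zero d).hasSum (y := u)
    (by simp [abs_of_pos h0, h1, enorm_eq_nnnorm, ← NNReal.coe_lt_coe])
  simp only [zero_add, FormalMultilinearSeries.ofScalars_apply_eq, smul_eq_mul, choose_eq] at h
  rw [Real.rpow_neg (by linarith), inv_eq_one_div]
  exact h

lemma Gamma_poch {a : ℝ} (ha : 0 < a) (k : ℕ) : Gamma (a + k) = poch a k * Gamma a := by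
  induction k with
  | zero => simp [poch]
  | succ n ih =>
    rw [poch_succ, Nat.cast_succ, ← add_assoc, Real.Gamma_add_one (by positivity), ih]; ring

lemma beta_one {s : ℝ} (hs : 0 < s) : beta s 1 = 1 / s := by
  have := Real.Gamma_pos_of_pos hs
  rw [beta, Real.Gamma_add_one hs.ne', Real.Gamma_one]
  field_simp
noncomputable def CC (d : ℝ) : ℝ≥0∞ :=
  ∫⁻ x, ∫⁻ z, qq 0 (1 - x) * qq 0 z * qq (1 - 2*d) (x - z) * qq (-d) (1 - z) * qq (-d) x

lemma CC_series (d : ℝ) (h0 : 0 ≤ d) (h1 : d < 1/2) :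
    CC d = ∑' k : ℕ, ENNReal.ofReal (poch d k / k.factorial *
      (beta (3 - 3*d + k) 1 * beta (k + 1) (2 - 2*d))) := by
  have key : ∀ x : ℝ, ∫⁻ z, qq 0 (1 - x) * qq 0 z * qq (1 - 2*d) (x - z) * qq (-d) (1 - z) * qq (-d) x
      = ∫⁻ t, ∑' k : ℕ, ENNReal.ofReal (poch d k / k.factorial) *
        ((qq (2 - 3*d + k) x * qq 0 (1 - x)) * (qq k t * qq (1 - 2*d) (1 - t))) := by
    intro x
    rcases le_or_gt x 0 with hx | hx
    · simp [qq_neg _ hx]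
    rcases le_or_gt (1 - x) 0 with hx1 | hx1
    · simp [qq_neg _ hx1]
    rw [subst_aff _ (by fun_prop) 0 hx, ← lintegral_const_mul' _ _ ENNReal.ofReal_ne_top]
    refine lintegral_congr fun t => ?_
    rcases le_or_gt t 0 with ht | ht
    · rw [zero_add, qq_scale _ _ hx, qq_neg _ ht]
      simp [qq_neg _ ht]
    rcases le_or_gt (1 - t) 0 with ht1 | ht1
    · rw [zero_add, show x - x * t = x * (1 - t) by ring, qq_scale (1 - 2*d) _ hx,
        qq_neg _ ht1]
      simp
    have hxt : 0 < x * t := by positivity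
    have hxt1 : x * t < 1 := by nlinarith
    have hs := binom d hxt hxt1
    rw [zero_add, qq_pos (-d) (show 0 < 1 - x * t by linarith), ← hs.tsum_eq,
      ENNReal.ofReal_tsum_of_nonneg _ hs.summable]
    · rw [mul_comm _ (∑' n : ℕ, ENNReal.ofReal _), mul_assoc, mul_left_comm, ← ENNReal.tsum_mul_right]
      refine tsum_congr fun k => ?_
      have hp := poch_nonneg h0 k
      rw [show x - x * t = x * (1 - t) by ring]
      rw [qq_pos _ hxt, qq_pos _ hx1, qq_pos _ (mul_pos hx ht1), qq_pos _ hx, qq_pos _ hx,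
        qq_pos _ ht, qq_pos _ ht1, Real.rpow_zero, Real.rpow_zero,
        ENNReal.ofReal_mul (by positivity), mul_assoc]
      congr 1
      have e : x ^ (2 - 3 * d + k) = x ^ k * (x * x ^ (1 - 2*d) * x ^ (-d)) := by
        rw [show 2 - 3 * d + k = k + (1 + (1 - 2*d) + (-d)) by ring, Real.rpow_add hx,
          Real.rpow_add hx, Real.rpow_add hx, Real.rpow_one, Real.rpow_natCast]
      rw [e, Real.rpow_natCast, Real.mul_rpow hx.le ht1.le, mul_pow]
      have A1 : 0 ≤ x ^ (1 - 2*d) := by positivity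
      have A2 : 0 ≤ x ^ (-d) := by positivity
      have A3 : 0 ≤ (1 - t) ^ (1 - 2*d) := by positivity
      have A4 : 0 ≤ x ^ k := by positivity
      have A5 : 0 ≤ t ^ k := by positivity
      simp only [ENNReal.ofReal_mul, ENNReal.ofReal_one, A1, A2, A3, A4, A5, hx.le, mul_nonneg, one_mul, mul_one]
      ring
    · intro k
      have hp := poch_nonneg h0 k
      positivity
  unfold CC
  simp_rw [key]
  have e1 : ∀ x : ℝ, ∫⁻ t, ∑' k : ℕ, ENNReal.ofReal (poch d k / k.factorial) *
        ((qq (2 - 3*d + k) x * qq 0 (1 - x)) * (qq k t * qq (1 - 2*d) (1 - t))) =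
      ∑' k : ℕ, ENNReal.ofReal (poch d k / k.factorial) *
        ((qq (2 - 3*d + k) x * qq 0 (1 - x)) * ENNReal.ofReal (beta (k + 1) (2 - 2*d))) := by
    intro x
    rw [lintegral_tsum (fun k => Measurable.aemeasurable (by fun_prop))]
    refine tsum_congr fun k => ?_
    rw [lintegral_const_mul _ (by fun_prop), lintegral_const_mul _ (by fun_prop),
      qq_beta (by have : (0:ℝ) ≤ k := by positivity
                  linarith) (by linarith), show 1 - 2*d + 1 = 2 - 2*d by ring]
  simp_rw [e1]
  rw [lintegral_tsum (fun k => Measurable.aemeasurable (by fun_prop))]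
  refine tsum_congr fun k => ?_
  have hk : (0:ℝ) ≤ k := by positivity
  have hp := poch_nonneg h0 k
  rw [lintegral_const_mul _ (by fun_prop), lintegral_mul_const _ (by fun_prop),
    qq_beta (by linarith) (by linarith), show 2 - 3*d + k + 1 = 3 - 3*d + k by ring, zero_add,
    ENNReal.ofReal_mul (by positivity), ENNReal.ofReal_mul (beta_pos (by linarith) (by linarith)).le]

lemma poch_le {a b : ℝ} (ha : 0 ≤ a) (hab : a ≤ b) (k : ℕ) : poch a k ≤ poch b k :=
  Finset.prod_le_prod (fun i _ => by positivity) fun i _ => by linarith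

lemma poch_one (k : ℕ) : poch 1 k = k.factorial := by
  induction k with
  | zero => simp [poch]
  | succ n ih => rw [poch_succ, ih, Nat.factorial_succ]; push_cast; ring

lemma poch_shift (a : ℝ) (k : ℕ) : a * poch (a + 1) k = poch a k * (a + k) := by
  induction k with
  | zero => simp [poch]
  | succ n ih => rw [poch_succ, ← mul_assoc, ih, poch_succ]; push_cast; ring

lemma CC_term (d : ℝ) (h0 : 0 ≤ d) (h1 : d < 1/2) (k : ℕ) :
    poch d k / k.factorial * (beta (3 - 3*d + k) 1 * beta (k + 1) (2 - 2*d)) =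
    1 / (6 * (1 - d)^2) * (poch 1 k * poch d k * poch (3 - 3*d) k /
      (poch (3 - 2*d) k * poch (4 - 3*d) k * (Nat.factorial k : ℝ))) := by
  have hk : (0:ℝ) ≤ k := by positivity
  have hf : (k.factorial : ℝ) ≠ 0 := by positivity
  rw [beta_one (by linarith), beta, poch_one, Real.Gamma_nat_eq_factorial,
    show (k:ℝ) + 1 + (2 - 2*d) = (3 - 2*d) + k by ring, Gamma_poch (by linarith),
    show 3 - 2*d = (2 - 2*d) + 1 by ring, Real.Gamma_add_one (by linarith)]
  have hs := poch_shift (3 - 3*d) k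
  rw [show 3 - 3*d + 1 = 4 - 3*d by ring] at hs
  have g := (Real.Gamma_pos_of_pos (show 0 < 2 - 2*d by linarith)).ne'
  have p1 := (poch_pos (show 0 < 2 - 2*d + 1 by linarith) k).ne'
  have p2 := (poch_pos (show 0 < 4 - 3*d by linarith) k).ne'
  have n1 : 3 - 3*d + k ≠ 0 := by linarith
  have n2 : 1 - d ≠ 0 := by linarith
  have n3 : 2 - 2*d ≠ 0 := by linarith
  generalize poch (2 - 2*d + 1) k = P1 at *
  generalize poch (4 - 3*d) k = P2 at *
  generalize poch (3 - 3*d) k = P3 at *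
  generalize Gamma (2 - 2*d) = G at *
  rw [show 6 * (1 - d)^2 = (2 - 2*d) * (3 * (1 - d)) by ring]
  generalize 2 - 2*d = w at *
  generalize hu : 3 - 3*d + k = u at *
  field_simp
  linear_combination poch d k * hs

lemma CC_summable (d : ℝ) (h0 : 0 ≤ d) (h1 : d < 1/2) :
    Summable (fun k : ℕ => poch d k / k.factorial * (beta (3 - 3*d + k) 1 * beta (k + 1) (2 - 2*d))) := by
  have hs : Summable (fun k : ℕ => 1 / ((k + 1 : ℕ) : ℝ)^2) :=
    (summable_nat_add_iff 1).2 (Real.summable_one_div_nat_pow.2 one_lt_two)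
  refine hs.of_nonneg_of_le (fun k => ?_) (fun k => ?_)
  · have hk : (0:ℝ) ≤ k := by positivity
    have hp := poch_nonneg h0 k
    have b1 := beta_pos (show 0 < 3 - 3*d + k by linarith) one_pos
    have b2 := beta_pos (show (0:ℝ) < k + 1 by linarith) (show 0 < 2 - 2*d by linarith)
    positivity
  · have hk : (0:ℝ) ≤ k := by positivity
    rw [beta_one (by linarith), beta, Real.Gamma_nat_eq_factorial,
      show (k:ℝ) + 1 + (2 - 2*d) = (3 - 2*d) + k by ring, Gamma_poch (by linarith),
      show 3 - 2*d = (2 - 2*d) + 1 by ring, Real.Gamma_add_one (by linarith)]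
    have g := (Real.Gamma_pos_of_pos (show 0 < 2 - 2*d by linarith))
    have p1 := (poch_pos (show 0 < 2 - 2*d + 1 by linarith) k)
    have hp := poch_nonneg h0 k
    have p3 : poch d k ≤ k.factorial := by rw [← poch_one]; exact poch_le h0 (by linarith) k
    have p4 : poch (1 + 1) k ≤ poch (2 - 2*d + 1) k := poch_le (by norm_num) (by linarith) k
    have p5 := poch_shift 1 k
    rw [poch_one, one_mul] at p5
    rw [p5] at p4
    have hf : (0:ℝ) < k.factorial := by positivity
    have c1 : (k:ℝ) + 1 ≤ 3 - 3*d + k := by linarith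
    have e : poch d k / k.factorial * (1 / (3 - 3*d + k) * ((k.factorial : ℝ) * Gamma (2 - 2*d) /
        (poch (2 - 2*d + 1) k * ((2 - 2*d) * Gamma (2 - 2*d))))) =
        poch d k / ((3 - 3*d + k) * (poch (2 - 2*d + 1) k * (2 - 2*d))) := by
      generalize poch (2 - 2*d + 1) k = P1 at *
      generalize Gamma (2 - 2*d) = G at *
      generalize 2 - 2*d = w at *
      generalize 3 - 3*d + k = u at *
      field_simp
    rw [e]
    have c2 : (k.factorial:ℝ) * (1 + k) ≤ poch (2 - 2*d + 1) k * (2 - 2*d) := by nlinarith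
    rw [div_le_div_iff₀ (by have : 0 < 2 - 2*d := by linarith
                            have : 0 < 3 - 3*d + k := by linarith
                            positivity) (by positivity)]
    push_cast
    calc poch d k * ((k:ℝ)+1)^2 ≤ k.factorial * ((k:ℝ)+1)^2 := by gcongr
      _ = ((k:ℝ)+1) * (k.factorial * (1 + k)) := by ring
      _ ≤ (3 - 3*d + k) * (poch (2 - 2*d + 1) k * (2 - 2*d)) := by gcongr; linarith
      _ = _ := by ring

lemma CC_eq (d : ℝ) (h0 : 0 ≤ d) (h1 : d < 1/2) :
    CC d = ENNReal.ofReal (1 / (6 * (1 - d)^2) * F32 1 d (3-3*d) (3-2*d) (4-3*d)) := by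
  rw [CC_series d h0 h1, ← ENNReal.ofReal_tsum_of_nonneg _ (CC_summable d h0 h1)]
  · rw [F32, ← tsum_mul_left]
    congr 1
    exact tsum_congr fun k => CC_term d h0 h1 k
  · intro k
    have hk : (0:ℝ) ≤ k := by positivity
    have hp := poch_nonneg h0 k
    have b1 := beta_pos (show 0 < 3 - 3*d + k by linarith) one_pos
    have b2 := beta_pos (show (0:ℝ) < k + 1 by linarith) (show 0 < 2 - 2*d by linarith)
    positivity
noncomputable def MM (d y1 y2 y4 y5 : ℝ) : ℝ≥0∞ :=
  qq 0 (1 - y1) * qq 0 (y1 - y2) * qq 0 (y4 - y5) * qq 0 y5 * qq (-d) (y1 - y4) *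
    qq (-d) (y1 - y5) * qq (-d) (y2 - y5)

noncomputable def KK (d y1 y2 y3 y4 y5 : ℝ) : ℝ≥0∞ :=
  MM d y1 y2 y4 y5 * (qq (-d) (y2 - y3) * qq (-d) (y3 - y4))

@[fun_prop]
lemma MM_meas {α : Type*} [MeasurableSpace α] (d : ℝ) (f1 f2 f4 f5 : α → ℝ) (h1 : Measurable f1)
    (h2 : Measurable f2) (h4 : Measurable f4) (h5 : Measurable f5) :
    Measurable (fun x => MM d (f1 x) (f2 x) (f4 x) (f5 x)) := by
  unfold MM; fun_prop

@[fun_prop]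
lemma KK_meas {α : Type*} [MeasurableSpace α] (d : ℝ) (f1 f2 f3 f4 f5 : α → ℝ) (h1 : Measurable f1)
    (h2 : Measurable f2) (h3 : Measurable f3) (h4 : Measurable f4) (h5 : Measurable f5) :
    Measurable (fun x => KK d (f1 x) (f2 x) (f3 x) (f4 x) (f5 x)) := by
  unfold KK; fun_prop

@[fun_prop]
lemma lint_meas {α : Type*} [MeasurableSpace α] (f : α → ℝ → ℝ≥0∞)
    (hf : Measurable (fun p : α × ℝ => f p.1 p.2)) : Measurable (fun x => ∫⁻ y, f x y) :=
  Measurable.lintegral_prod_right' hf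

lemma swap2 (f : ℝ → ℝ → ℝ≥0∞) (hf : Measurable (fun p : ℝ × ℝ => f p.1 p.2)) :
    ∫⁻ x, ∫⁻ y, f x y = ∫⁻ y, ∫⁻ x, f x y :=
  lintegral_lintegral_swap hf.aemeasurable

lemma inner_eq (d y1 y5 : ℝ) :
    ∫⁻ y2, ∫⁻ y4, MM d y1 y2 y4 y5 * qq (1 - 2*d) (y2 - y4) =
      qq 0 (1 - y1) * qq (3 - 5*d) (y1 - y5) * qq 0 y5 * CC d := by
  rcases le_or_gt (y1 - y5) 0 with h | h
  · simp [MM, qq_neg _ h]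
  set l := y1 - y5 with hl
  rw [subst_aff _ (by fun_prop) y5 h]
  have e : ∀ x, ∫⁻ y4, MM d y1 (y5 + l * x) y4 y5 * qq (1 - 2*d) (y5 + l * x - y4) =
      (ENNReal.ofReal (l ^ (2 - 5*d)) * qq 0 (1 - y1) * qq 0 y5) *
      ∫⁻ z, qq 0 (1 - x) * qq 0 z * qq (1 - 2*d) (x - z) * qq (-d) (1 - z) * qq (-d) x := by
    intro x
    rw [subst_aff _ (by fun_prop) y5 h, ← lintegral_const_mul _ (by fun_prop),
      ← lintegral_const_mul _ (by fun_prop)]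
    refine lintegral_congr fun z => ?_
    rw [MM, show y1 - (y5 + l * x) = l * (1 - x) by rw [hl]; ring,
      show y5 + l * z - y5 = l * z by ring, show y5 + l * x - y5 = l * x by ring,
      show y1 - (y5 + l * z) = l * (1 - z) by rw [hl]; ring,
      show y5 + l * x - (y5 + l * z) = l * (x - z) by ring, ← hl]
    simp only [qq_scale _ _ h]
    rw [qq_pos _ h, Real.rpow_zero, ENNReal.ofReal_one,
      show 2 - 5*d = 1 + (-d) + (-d) + (-d) + (1 - 2*d) by ring, Real.rpow_add h, Real.rpow_add h,
      Real.rpow_add h, Real.rpow_add h, Real.rpow_one]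
    have A1 : 0 ≤ l ^ (-d) := by positivity
    have A2 : 0 ≤ l ^ (1 - 2*d) := by positivity
    rw [ENNReal.ofReal_mul (by positivity), ENNReal.ofReal_mul (by positivity),
      ENNReal.ofReal_mul (by positivity), ENNReal.ofReal_mul (by positivity)]
    ring
  simp_rw [e]
  rw [lintegral_const_mul _ (by fun_prop), ← CC, qq_pos (3 - 5*d) h,
    show 3 - 5*d = 1 + (2 - 5*d) by ring, Real.rpow_add h, Real.rpow_one, ENNReal.ofReal_mul h.le]
  ring

lemma total (d : ℝ) (h0 : 0 ≤ d) (h1 : d < 1/2) :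
    ∫⁻ y1, ∫⁻ y2, ∫⁻ y3, ∫⁻ y4, ∫⁻ y5, KK d y1 y2 y3 y4 y5 =
      ENNReal.ofReal (beta (1-d) (1-d)) *
      (ENNReal.ofReal (beta (4 - 5*d) 1) * ENNReal.ofReal (beta 1 (5 - 5*d)) * CC d) := by
  have s1 : ∀ y1 y2, ∫⁻ y3, ∫⁻ y4, ∫⁻ y5, KK d y1 y2 y3 y4 y5 =
      ∫⁻ y5, ∫⁻ y4, ENNReal.ofReal (beta (1-d) (1-d)) * (MM d y1 y2 y4 y5 * qq (1 - 2*d) (y2 - y4)) := by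
    intro y1 y2
    rw [swap2 _ (by fun_prop), swap2 _ (by fun_prop)]
    have : ∀ y4, ∫⁻ y3, ∫⁻ y5, KK d y1 y2 y3 y4 y5 = ∫⁻ y5, ENNReal.ofReal (beta (1-d) (1-d)) * (MM d y1 y2 y4 y5 * qq (1 - 2*d) (y2 - y4)) := by
      intro y4
      rw [swap2 _ (by fun_prop)]
      refine lintegral_congr fun y5 => ?_
      unfold KK
      rw [lintegral_const_mul _ (by fun_prop), qq_conv (by linarith) (by linarith),
        show -d + 1 = 1 - d by ring, show -d + -d + 1 = 1 - 2*d by ring]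
      ring
    first
    | (simp_rw [this])
    | (rw [swap2 _ (by fun_prop)]; simp_rw [this]; rw [swap2 _ (by fun_prop)])
  simp_rw [s1]
  have s2 : ∀ y1, ∫⁻ y2, ∫⁻ y5, ∫⁻ y4, ENNReal.ofReal (beta (1-d) (1-d)) * (MM d y1 y2 y4 y5 * qq (1 - 2*d) (y2 - y4)) = ∫⁻ y5, ENNReal.ofReal (beta (1-d) (1-d)) *
        (qq 0 (1 - y1) * qq (3 - 5*d) (y1 - y5) * qq 0 y5 * CC d) := by
    intro y1
    rw [swap2 _ (by fun_prop)]
    refine lintegral_congr fun y5 => ?_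
    rw [← inner_eq, ← lintegral_const_mul _ (by fun_prop)]
    refine lintegral_congr fun y2 => ?_
    rw [← lintegral_const_mul _ (by fun_prop)]
  simp_rw [s2]
  rw [swap2 _ (by fun_prop)]
  have s3 : ∀ y5, ∫⁻ y1, ENNReal.ofReal (beta (1-d) (1-d)) *
        (qq 0 (1 - y1) * qq (3 - 5*d) (y1 - y5) * qq 0 y5 * CC d) =
      (ENNReal.ofReal (beta (1-d) (1-d)) * ENNReal.ofReal (beta (4 - 5*d) 1) * CC d) *
        (qq (4 - 5*d) (1 - y5) * qq 0 (y5 - 0)) := by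
    intro y5
    rw [lintegral_const_mul _ (by fun_prop), lintegral_mul_const _ (by fun_prop),
      lintegral_mul_const _ (by fun_prop), qq_conv (by linarith) (by linarith),
      show 3 - 5*d + 1 = 4 - 5*d by ring, show 0 + (3 - 5*d) + 1 = 4 - 5*d by ring, zero_add, sub_zero]
    ring
  simp_rw [s3]
  rw [lintegral_const_mul _ (by fun_prop), qq_conv (by linarith) (by linarith),
    qq_pos _ (by norm_num), sub_zero, Real.one_rpow, ENNReal.ofReal_one, mul_one, zero_add,
    show 4 - 5*d + 1 = 5 - 5*d by ring]
  ring

lemma total' (d : ℝ) (h0 : 0 ≤ d) (h1 : d < 1/2) :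
    ∫⁻ y1, ∫⁻ y2, ∫⁻ y3, ∫⁻ y4, ∫⁻ y5, KK d y1 y2 y3 y4 y5 =
      ENNReal.ofReal (Gamma (1-d) ^ 2 / (3 * (1-d)) * (Gamma (4-5*d) / (Gamma (6-5*d) * Gamma (3-2*d))) *
      F32 1 d (3-3*d) (3-2*d) (4-3*d)) := by
  have b1 := beta_pos (show 0 < 1 - d by linarith) (show 0 < 1 - d by linarith)
  have b2 := beta_pos (show 0 < 4 - 5*d by linarith) one_pos
  have b3 := beta_pos one_pos (show 0 < 5 - 5*d by linarith)
  rw [total d h0 h1, CC_eq d h0 h1, ← ENNReal.ofReal_mul b2.le, ← ENNReal.ofReal_mul (by positivity),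
    ← ENNReal.ofReal_mul b1.le]
  congr 1
  simp only [beta]
  rw [show 1 - d + (1 - d) = 2 - 2*d by ring, show 4 - 5*d + 1 = 5 - 5*d by ring,
    show 1 + (5 - 5*d) = 6 - 5*d by ring, show 3 - 2*d = (2 - 2*d) + 1 by ring,
    Real.Gamma_add_one (show 2 - 2*d ≠ 0 by linarith), Real.Gamma_one]
  have g1 := (Real.Gamma_pos_of_pos (show 0 < 2 - 2*d by linarith)).ne'
  have g2 := (Real.Gamma_pos_of_pos (show 0 < 5 - 5*d by linarith)).ne'
  have g3 := (Real.Gamma_pos_of_pos (show 0 < 6 - 5*d by linarith)).ne'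
  have n2 : 1 - d ≠ 0 := by linarith
  have n3 : 2 - 2*d ≠ 0 := by linarith
  rw [show 6 * (1 - d)^2 = (2 - 2*d) * (3 * (1 - d)) by ring]
  generalize Gamma (2 - 2*d) = G1 at *
  generalize Gamma (5 - 5*d) = G2 at *
  generalize Gamma (6 - 5*d) = G3 at *
  generalize Gamma (4 - 5*d) = G4 at *
  generalize F32 _ _ _ _ _ = F at *
  generalize 2 - 2*d = w at *
  field_simp

lemma KK_zero (d y1 y2 y3 y4 y5 : ℝ) (h : 1 ≤ y1 ∨ y1 ≤ y2 ∨ y2 ≤ y3 ∨ y3 ≤ y4 ∨ y4 ≤ y5 ∨ y5 ≤ 0) :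
    KK d y1 y2 y3 y4 y5 = 0 := by
  rw [KK, MM]
  rcases h with h | h | h | h | h | h
  · rw [qq_neg 0 (show 1 - y1 ≤ 0 by linarith)]; simp
  · rw [qq_neg 0 (show y1 - y2 ≤ 0 by linarith)]; simp
  · rw [qq_neg (-d) (show y2 - y3 ≤ 0 by linarith)]; simp
  · rw [qq_neg (-d) (show y3 - y4 ≤ 0 by linarith)]; simp
  · rw [qq_neg 0 (show y4 - y5 ≤ 0 by linarith)]; simp
  · rw [qq_neg 0 h]; simp

lemma KK_zero' (d y1 y2 y3 y4 y5 : ℝ) (h : y1 ≤ 0 ∨ y2 ≤ 0 ∨ y3 ≤ 0 ∨ y4 ≤ 0 ∨ y5 ≤ 0) :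
    KK d y1 y2 y3 y4 y5 = 0 := by
  by_contra hc
  have := mt (KK_zero d y1 y2 y3 y4 y5) hc
  simp only [not_or, not_le] at this
  obtain ⟨a1, a2, a3, a4, a5, a6⟩ := this
  rcases h with h | h | h | h | h <;> linarith

theorem stmt13 (d : ℝ) (h0 : 0 ≤ d) (h1 : d < 1/2) :
    (∫ y1 in (0:ℝ)..1, ∫ y2 in (0:ℝ)..y1, ∫ y3 in (0:ℝ)..y2, ∫ y4 in (0:ℝ)..y3, ∫ y5 in (0:ℝ)..y4,
      (y2 - y3) ^ (-d) * (y3 - y4) ^ (-d) * (y1 - y4) ^ (-d) * (y1 - y5) ^ (-d) * (y2 - y5) ^ (-d)) =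
    Gamma (1-d) ^ 2 / (3 * (1-d)) * (Gamma (4-5*d) / (Gamma (6-5*d) * Gamma (3-2*d))) *
      F32 1 d (3-3*d) (3-2*d) (4-3*d) := by
  have T := total' d h0 h1
  rw [step one_pos _ (fun y1 => ∫⁻ y2, ∫⁻ y3, ∫⁻ y4, ∫⁻ y5, KK d y1 y2 y3 y4 y5) (by fun_prop) ?_ ?_
    (T ▸ ENNReal.ofReal_lt_top)]
  · rw [T, ENNReal.toReal_ofReal]
    have g1 := (Real.Gamma_pos_of_pos (show 0 < 4 - 5*d by linarith))
    have g3 := (Real.Gamma_pos_of_pos (show 0 < 6 - 5*d by linarith))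
    have g4 := (Real.Gamma_pos_of_pos (show 0 < 3 - 2*d by linarith))
    have n : 0 < 1 - d := by linarith
    have hF : 0 ≤ F32 1 d (3-3*d) (3-2*d) (4-3*d) := by
      refine tsum_nonneg fun k => ?_
      have p0 := poch_nonneg h0 k
      have p1 := poch_pos one_pos k
      have p2 := poch_pos (show 0 < 3 - 3*d by linarith) k
      have p3 := poch_pos (show 0 < 3 - 2*d by linarith) k
      have p4 := poch_pos (show 0 < 4 - 3*d by linarith) k
      positivity
    positivity
  · intro y1 hy1 hy1' hf1
    refine step hy1 _ (fun y2 => ∫⁻ y3, ∫⁻ y4, ∫⁻ y5, KK d y1 y2 y3 y4 y5) (by fun_prop) ?_ ?_ hf1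
    · intro y2 hy2 hy2' hf2
      refine step hy2 _ (fun y3 => ∫⁻ y4, ∫⁻ y5, KK d y1 y2 y3 y4 y5) (by fun_prop) ?_ ?_ hf2
      · intro y3 hy3 hy3' hf3
        refine step hy3 _ (fun y4 => ∫⁻ y5, KK d y1 y2 y3 y4 y5) (by fun_prop) ?_ ?_ hf3
        · intro y4 hy4 hy4' hf4
          refine step hy4 _ (fun y5 => KK d y1 y2 y3 y4 y5) (by fun_prop) ?_ ?_ hf4
          · intro y5 hy5 hy5' hf5
            rw [KK, MM]
            have e1 : 0 < 1 - y1 := by linarith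
            have e2 : 0 < y1 - y2 := by linarith
            have e3 : 0 < y4 - y5 := by linarith
            have e4 : 0 < y1 - y4 := by linarith
            have e5 : 0 < y1 - y5 := by linarith
            have e6 : 0 < y2 - y5 := by linarith
            have e7 : 0 < y2 - y3 := by linarith
            have e8 : 0 < y3 - y4 := by linarith
            rw [qq_pos _ e1, qq_pos _ e2, qq_pos _ e3, qq_pos _ e4, qq_pos _ e5, qq_pos _ e6,
              qq_pos _ e7, qq_pos _ e8, qq_pos _ hy5]
            simp only [ENNReal.toReal_mul, Real.rpow_zero]
            rw [ENNReal.toReal_ofReal (by positivity), ENNReal.toReal_ofReal (by positivity),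
              ENNReal.toReal_ofReal (by positivity), ENNReal.toReal_ofReal (by positivity),
              ENNReal.toReal_ofReal (by positivity), ENNReal.toReal_ofReal (by positivity)]
            ring
          · rintro y5 (h | h)
            · exact KK_zero' _ _ _ _ _ _ (by tauto)
            · exact KK_zero _ _ _ _ _ _ (by tauto)
        · rintro y4 (h | h)
          · simp [show ∀ a, KK d y1 y2 y3 y4 a = 0 from fun a => KK_zero' d y1 y2 y3 y4 a (by tauto)]
          · simp [show ∀ a, KK d y1 y2 y3 y4 a = 0 from fun a => KK_zero d y1 y2 y3 y4 a (by tauto)]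
      · rintro y3 (h | h)
        · simp [show ∀ a b, KK d y1 y2 y3 a b = 0 from fun a b => KK_zero' d y1 y2 y3 a b (by tauto)]
        · simp [show ∀ a b, KK d y1 y2 y3 a b = 0 from fun a b => KK_zero d y1 y2 y3 a b (by tauto)]
    · rintro y2 (h | h)
      · simp [show ∀ a b c, KK d y1 y2 a b c = 0 from fun a b c => KK_zero' d y1 y2 a b c (by tauto)]
      · simp [show ∀ a b c, KK d y1 y2 a b c = 0 from fun a b c => KK_zero d y1 y2 a b c (by tauto)]
  · rintro y1 (h | h)
    · simp [show ∀ a b c e, KK d y1 a b c e = 0 from fun a b c e => KK_zero' d y1 a b c e (by tauto)]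
    · simp [show ∀ a b c e, KK d y1 a b c e = 0 from fun a b c e => KK_zero d y1 a b c e (by tauto)]
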